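/- For all integers k > 2, r > 2 and n ≥ r, ex_↻(n, M_k^r) < 2(k−1)(r−1) · C(n, r−1). -/

import Mathlib

/-- `CycChain ℓ w` says that starting at `w 0` and moving clockwise around the cyclically
ordered set `Fin n` (clockwise = increasing residues), one encounters
`w 1, w 2, ..., w (ℓ-1)` in this order, i.e. `w 0 < w 1 < ... < w (ℓ-1) (< w 0)`
in the cyclic order. -/
def CycChain {n : ℕ} (ℓ : ℕ) (w : ℕ → Fin n) : Prop :=
  ∀ i j : ℕ, i < j → j < ℓ → w i - w 0 < w j - w 0

/-- `IsCycCrossMatching r k H v` says that the distinct vertices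
`v 0 < v 1 < ... < v (r*k-1)` (in the clockwise cyclic order on `Fin n`) carry a crossing
`k`-matching `M_k^r` in `H`: the `k` pairwise disjoint edges
`{v i, v (i+k), v (i+2k), ..., v (i+(r-1)k)}` for `0 ≤ i ≤ k-1` all belong to `H`. -/
def IsCycCrossMatching (r k : ℕ) {n : ℕ} (H : Finset (Finset (Fin n))) (v : ℕ → Fin n) : Prop :=
  CycChain (r * k) v ∧
  ∀ i : ℕ, i < k → Finset.image (fun j => v (i + j * k)) (Finset.range r) ∈ H

/-- `IsOrdCrossMatching r k H v` says that the distinct vertices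
`v 0 < v 1 < ... < v (r*k-1)` (in the linear order on `Fin n`) carry a crossing
`k`-matching `M_k^r` in `H`: the `k` pairwise disjoint edges
`{v i, v (i+k), v (i+2k), ..., v (i+(r-1)k)}` for `0 ≤ i ≤ k-1` all belong to `H`. -/
def IsOrdCrossMatching (r k : ℕ) {n : ℕ} (H : Finset (Finset (Fin n))) (v : ℕ → Fin n) : Prop :=
  (∀ i j : ℕ, i < j → j < r * k → v i < v j) ∧
  ∀ i : ℕ, i < k → Finset.image (fun j => v (i + j * k)) (Finset.range r) ∈ H

/-- `exCycM n r k` is the maximum number of edges in an `n`-vertex convex geometric `r`-graph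
containing no crossing `k`-matching `M_k^r`. -/
noncomputable def exCycM (n r k : ℕ) : ℕ :=
  sSup {m | ∃ H : Finset (Finset (Fin n)),
    (∀ e ∈ H, e.card = r) ∧ (¬ ∃ v : ℕ → Fin n, IsCycCrossMatching r k H v) ∧ H.card = m}

/-- `exOrdM n r k` is the maximum number of edges in an `n`-vertex ordered `r`-graph
containing no crossing `k`-matching `M_k^r`. -/
noncomputable def exOrdM (n r k : ℕ) : ℕ :=
  sSup {m | ∃ H : Finset (Finset (Fin n)),
    (∀ e ∈ H, e.card = r) ∧ (¬ ∃ v : ℕ → Fin n, IsOrdCrossMatching r k H v) ∧ H.card = m}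

/-- `HasCrossing E K` says that the set `E` of pairs, read as the edges `{x, y}` of an ordered
graph, contains `K + 1` pairwise crossing edges. -/
def HasCrossing (E : Finset (ℕ × ℕ)) (K : ℕ) : Prop :=
  ∃ p : ℕ → ℕ × ℕ, (∀ i ≤ K, p i ∈ E) ∧
    (∀ i < K, (p i).1 < (p (i + 1)).1 ∧ (p i).2 < (p (i + 1)).2) ∧ (p K).1 < (p 0).2

/-- The first coordinates of the greedy increasing chain through the columns `c, c + 1, …` of `E`;
the value `c` means that the chain has stopped. -/
noncomputable def greedyRow (E : Finset (ℕ × ℕ)) (c : ℕ) : ℕ → ℕ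
  | 0 => sInf {x | x = c ∨ (x, c) ∈ E}
  | i + 1 => sInf {x | x = c ∨ (greedyRow E c i < x ∧ (x, c + i + 1) ∈ E)}

section GreedyRow

variable {E : Finset (ℕ × ℕ)} {c : ℕ}

theorem greedyRow_zero : greedyRow E c 0 = c ∨ (greedyRow E c 0, c) ∈ E :=
  Nat.sInf_mem (s := {x | x = c ∨ (x, c) ∈ E}) ⟨c, Or.inl rfl⟩

theorem greedyRow_succ (i : ℕ) : greedyRow E c (i + 1) = c ∨
    (greedyRow E c i < greedyRow E c (i + 1) ∧ (greedyRow E c (i + 1), c + i + 1) ∈ E) :=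
  Nat.sInf_mem (s := {x | x = c ∨ (greedyRow E c i < x ∧ (x, c + i + 1) ∈ E)}) ⟨c, Or.inl rfl⟩

theorem greedyRow_le (i : ℕ) : greedyRow E c i ≤ c := by
  cases i <;> exact Nat.sInf_le (Or.inl rfl)

theorem greedyRow_zero_le {x : ℕ} (h : (x, c) ∈ E) : greedyRow E c 0 ≤ x :=
  Nat.sInf_le (Or.inr h)

theorem greedyRow_succ_le {x i : ℕ} (hx : greedyRow E c i < x) (h : (x, c + i + 1) ∈ E) :
    greedyRow E c (i + 1) ≤ x :=
  Nat.sInf_le (Or.inr ⟨hx, h⟩)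

theorem greedyRow_mem {i : ℕ} (h : greedyRow E c i < c) : (greedyRow E c i, c + i) ∈ E := by
  cases i with
  | zero => exact greedyRow_zero.resolve_left h.ne
  | succ i => exact ((greedyRow_succ i).resolve_left h.ne).2

theorem greedyRow_mono : Monotone (greedyRow E c) := by
  refine monotone_nat_of_le_succ fun i => ?_
  rcases greedyRow_succ (E := E) (c := c) i with h | h
  · rw [h]
    exact greedyRow_le i
  · exact h.1.le

theorem greedyRow_lt {i j : ℕ} (hij : i < j) (h : greedyRow E c j < c) :
    greedyRow E c i < greedyRow E c j := by
  have h1 : greedyRow E c (i + 1) ≤ greedyRow E c j := greedyRow_mono hij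
  rcases greedyRow_succ (E := E) (c := c) i with h' | h' <;> omega

end GreedyRow

open Classical in
/-- Push to the left by one column every edge that lies above the greedy chain. -/
noncomputable def pushLeft (E : Finset (ℕ × ℕ)) (c : ℕ) (p : ℕ × ℕ) : ℕ × ℕ :=
  if p.2 < c ∨ greedyRow E c (p.2 - c) ≤ p.1 then p else (p.1, p.2 - 1)

section PushLeft

variable {E : Finset (ℕ × ℕ)} {c : ℕ}

theorem of_not_stays {p : ℕ × ℕ} (hp : p ∈ E)
    (h : ¬ (p.2 < c ∨ greedyRow E c (p.2 - c) ≤ p.1)) :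
    c + 1 ≤ p.2 ∧ p.1 ≤ greedyRow E c (p.2 - 1 - c) := by
  obtain ⟨x, y⟩ := p
  push Not at h
  obtain ⟨h1, h2⟩ := h
  simp only at h1 h2 ⊢
  obtain ⟨i, rfl⟩ := Nat.exists_eq_add_of_le h1
  simp only [Nat.add_sub_cancel_left] at h2
  cases i with
  | zero => exact absurd (greedyRow_zero_le (by simpa using hp)) (by omega)
  | succ i =>
    refine ⟨by omega, ?_⟩
    have : c + (i + 1) - 1 - c = i := by omega
    rw [this]
    by_contra! h3
    exact absurd (greedyRow_succ_le h3 (by simpa [add_assoc] using hp)) (by omega)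

theorem card_le_card_image_pushLeft_add (K : ℕ) (hE : ∀ p ∈ E, p.2 < c + 1 + K) :
    E.card ≤ (E.image (pushLeft E c)).card + K := by
  classical
  set B := (Finset.range K).image fun i => (greedyRow E c i, c + i + 1)
  have hB : B.card ≤ K := Finset.card_image_le.trans (Finset.card_range K).le
  have hinj : Set.InjOn (pushLeft E c) (E \ B : Finset (ℕ × ℕ)) := by
    have key : ∀ p ∈ E, ∀ q ∈ E \ B, (p.2 < c ∨ greedyRow E c (p.2 - c) ≤ p.1) →
        ¬ (q.2 < c ∨ greedyRow E c (q.2 - c) ≤ q.1) → p = (q.1, q.2 - 1) → False := by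
      intro p hp q hq h1 h2 he
      rw [Finset.mem_sdiff] at hq
      have h3 := of_not_stays hq.1 h2
      apply hq.2
      have hy := hE q hq.1
      subst he
      simp only at h1
      refine Finset.mem_image.2 ⟨q.2 - 1 - c, Finset.mem_range.2 (by omega), ?_⟩
      ext
      · simp only
        rcases h1 with h1 | h1 <;> omega
      · simp only
        omega
    intro p hp q hq h
    rw [Finset.mem_coe] at hp hq
    have hpE := (Finset.mem_sdiff.1 hp).1
    have hqE := (Finset.mem_sdiff.1 hq).1
    unfold pushLeft at h
    split_ifs at h with h1 h2 h2
    · exact h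
    · exact (key p hpE q hq h1 h2 h).elim
    · exact (key q hqE p hp h2 h1 h.symm).elim
    · have h3 := of_not_stays hpE h1
      have h4 := of_not_stays hqE h2
      rw [Prod.mk.injEq] at h
      ext
      · exact h.1
      · omega
  have h1 := Finset.card_le_card (Finset.image_subset_image (f := pushLeft E c)
    (Finset.sdiff_subset (s := E) (t := B)))
  rw [Finset.card_image_of_injOn hinj] at h1
  have h2 := Finset.le_card_sdiff B E
  omega

theorem hasCrossing_of_greedyRow_lt {K : ℕ} (h : greedyRow E c K < c) : HasCrossing E K := by
  have hlt : ∀ i ≤ K, greedyRow E c i < c := fun i hi => (greedyRow_mono hi).trans_lt h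
  refine ⟨fun i => (greedyRow E c i, c + i), fun i hi => greedyRow_mem (hlt i hi),
    fun i hi => ⟨greedyRow_lt (Nat.lt_succ_self i) (hlt _ hi), by simp only; omega⟩, by simpa⟩

theorem HasCrossing.of_image_pushLeft {K : ℕ} (hE : ∀ p ∈ E, p.1 < c)
    (h : HasCrossing (E.image (pushLeft E c)) K) : HasCrossing E K := by
  classical
  obtain ⟨p, hp, hlt, hK⟩ := h
  set S : ℕ → Prop := fun j =>
    p j ∈ E ∧ ((p j).2 < c ∨ greedyRow E c ((p j).2 - c) ≤ (p j).1) with hS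
  have hcase : ∀ j ≤ K, S j ∨ (((p j).1, (p j).2 + 1) ∈ E ∧ c ≤ (p j).2 ∧
      (p j).1 ≤ greedyRow E c ((p j).2 - c)) := by
    intro j hj
    obtain ⟨q, hq, he⟩ := Finset.mem_image.1 (hp j hj)
    unfold pushLeft at he
    split_ifs at he with h1
    · subst he
      exact Or.inl ⟨hq, h1⟩
    · have h2 := of_not_stays hq h1
      right
      rw [← he]
      simp only
      refine ⟨?_, by omega, h2.2⟩
      have : q.2 - 1 + 1 = q.2 := by omega
      rw [this]
      exact hq
  set L : ℕ → Prop := fun i => ∃ j, i ≤ j ∧ j ≤ K ∧ S j with hL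
  have hmono : ∀ i j, i ≤ j → j ≤ K → (p i).2 ≤ (p j).2 := by
    intro i j hij
    induction j, hij using Nat.le_induction with
    | base => exact fun _ => le_rfl
    | succ j hij ih => exact fun hj => (ih (by omega)).trans (hlt j (by omega)).2.le
  have hfin : ∀ i, L i → c ≤ (p i).2 → greedyRow E c ((p i).2 - c) < c := by
    rintro i ⟨j, hij, hj, hSj⟩ hc
    have h1 := hmono i j hij hj
    have h2 : greedyRow E c ((p i).2 - c) ≤ greedyRow E c ((p j).2 - c) :=
      greedyRow_mono (by omega)
    have h3 := hE _ hSj.1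
    rcases hSj.2 with h4 | h4 <;> omega
  set q : ℕ → ℕ × ℕ := fun i =>
    if L i then
      (if (p i).2 < c then p i else (max (p i).1 (greedyRow E c ((p i).2 - c)), (p i).2))
    else ((p i).1, (p i).2 + 1) with hq
  have hqS : ∀ i, i ≤ K → S i → q i = p i := by
    intro i hi hSi
    have : L i := ⟨i, le_rfl, hi, hSi⟩
    simp only [hq, if_pos this]
    split_ifs with h1
    · rfl
    · ext
      · exact max_eq_left (hSi.2.resolve_left h1)
      · rfl
  have hqN : ∀ i, ¬ L i → q i = ((p i).1, (p i).2 + 1) := fun i hi => by simp only [hq, if_neg hi]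
  have hqL : ∀ i, L i → (q i).2 = (p i).2 := by
    intro i hi
    simp only [hq, if_pos hi]
    split_ifs <;> rfl
  have hKq : (q K).1 = (p K).1 := by
    by_cases h1 : L K
    · obtain ⟨j, h2, h3, h4⟩ := h1
      obtain rfl : j = K := le_antisymm h3 h2
      rw [hqS j le_rfl h4]
    · rw [hqN K h1]
  refine ⟨q, ?_, ?_, ?_⟩
  · intro i hi
    by_cases h1 : L i
    · rcases hcase i hi with h2 | h2
      · exact hqS i hi h2 ▸ h2.1
      · simp only [hq, if_pos h1, if_neg h2.2.1.not_gt, max_eq_right h2.2.2]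
        have := greedyRow_mem (hfin i h1 h2.2.1)
        rwa [Nat.add_sub_cancel' h2.2.1] at this
    · rw [hqN i h1]
      refine ((hcase i hi).resolve_left fun h2 => h1 ⟨i, le_rfl, hi, h2⟩).1
  · intro i hi
    have hpi := hlt i hi
    by_cases h1 : L (i + 1)
    · have h0 : L i := by
        obtain ⟨j, h2, h3⟩ := h1
        exact ⟨j, by omega, h3⟩
      rw [hqL _ h0, hqL _ h1]
      refine ⟨?_, hpi.2⟩
      simp only [hq, if_pos h0, if_pos h1]
      split_ifs with h2 h3 h3
      · exact hpi.1
      · exact lt_max_of_lt_left hpi.1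
      · omega
      · have h4 : greedyRow E c ((p i).2 - c) < greedyRow E c ((p (i + 1)).2 - c) :=
          greedyRow_lt (by omega) (hfin _ h1 (by omega))
        exact max_lt_max hpi.1 h4
    · rw [hqN _ h1]
      by_cases h0 : L i
      · obtain ⟨j, h2, h3, h4⟩ := h0
        obtain rfl : j = i := by
          by_contra h5
          exact h1 ⟨j, by omega, h3, h4⟩
        rw [hqS j h3 h4]
        exact ⟨hpi.1, by simp only; omega⟩
      · rw [hqN _ h0]
        exact ⟨hpi.1, by simp only; omega⟩
  · rw [hKq]
    by_cases h1 : L 0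
    · rwa [hqL _ h1]
    · rw [hqN _ h1]
      simp only
      omega

end PushLeft

/-- A weak form of the Capoyleas–Pach theorem. -/
theorem card_le_of_not_hasCrossing {K : ℕ} (hK : 0 < K) (c : ℕ) (E : Finset (ℕ × ℕ))
    (hE : ∀ p ∈ E, p.1 < p.2 ∧ p.1 < c ∧ p.2 < c + K) (h : ¬ HasCrossing E K) :
    E.card ≤ 2 * K * c := by
  classical
  induction c generalizing E with
  | zero =>
    rw [Finset.eq_empty_of_forall_notMem (s := E) fun p hp => by simpa using (hE p hp).2.1]
    simp
  | succ c ih =>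
    set F := E.filter fun p => p.1 < c with hF
    have hFE : F ⊆ E := Finset.filter_subset _ _
    have hFc : ¬ HasCrossing F K := fun ⟨p, hp, hp'⟩ => h ⟨p, fun i hi => hFE (hp i hi), hp'⟩
    have h1 : (E \ F).card ≤ K := by
      have hsub : E \ F ⊆ (Finset.Ioc c (c + K)).image fun y => (c, y) := by
        intro p hp
        simp only [hF, Finset.mem_sdiff, Finset.mem_filter, not_and, not_lt] at hp
        have h2 := hE p hp.1
        have h3 := hp.2 hp.1
        refine Finset.mem_image.2 ⟨p.2, Finset.mem_Ioc.2 ⟨by omega, by omega⟩, ?_⟩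
        ext
        · simp only
          omega
        · rfl
      refine (Finset.card_le_card hsub).trans (Finset.card_image_le.trans ?_)
      simp
    have h2 : E.card = (E \ F).card + F.card := (Finset.card_sdiff_add_card_eq_card hFE).symm
    have h3 := card_le_card_image_pushLeft_add (E := F) (c := c) K fun p hp => (hE p (hFE hp)).2.2
    have hlt : ∀ p ∈ F, p.1 < c := fun p hp => (Finset.mem_filter.1 hp).2
    have h4 := ih (F.image (pushLeft F c)) ?_ fun hc => hFc (hc.of_image_pushLeft hlt)
    · rw [mul_add]
      omega
    · intro p' hp'
      obtain ⟨p, hp, rfl⟩ := Finset.mem_image.1 hp'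
      have h5 := hE p (hFE hp)
      have h6 := hlt p hp
      unfold pushLeft
      split_ifs with h7
      · refine ⟨h5.1, h6, ?_⟩
        by_contra! h8
        have h9 : p.2 = c + K := by omega
        refine hFc (hasCrossing_of_greedyRow_lt (c := c) ?_)
        rw [h9, Nat.add_sub_cancel_left] at h7
        omega
      · have h8 := of_not_stays hp h7
        simp only
        omega

/-- The `t`-th vertex of the edge with shape `d`, pivot `i` and base pair `p`. -/
def edgeVertex (d : ℕ → ℕ) (i : ℕ) (p : ℕ × ℕ) (t : ℕ) : ℕ :=
  if t ≤ i then p.1 + d t else p.2 + d (t - 1)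

theorem le_of_lt_succ {f : ℕ → ℕ} {m : ℕ} (h : ∀ t < m, f t < f (t + 1)) {s t : ℕ} (hst : s ≤ t)
    (ht : t ≤ m) : f s ≤ f t := by
  induction t, hst using Nat.le_induction with
  | base => exact le_rfl
  | succ t hst ih => exact (ih (by omega)).trans (h t (by omega)).le

theorem lt_of_lt_succ {f : ℕ → ℕ} {m : ℕ} (h : ∀ t < m, f t < f (t + 1)) {s t : ℕ} (hst : s < t)
    (ht : t ≤ m) : f s < f t :=
  (h s (by omega)).trans_le (le_of_lt_succ h hst ht)

/-- Every increasing sequence is the vertex sequence of an edge whose pivot is a smallest gap. -/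
theorem exists_edgeVertex_eq {q : ℕ} {a : ℕ → ℕ} (ha : ∀ t < q + 1, a t < a (t + 1)) :
    ∃ i ≤ q, ∃ d : ℕ → ℕ, ∃ p : ℕ × ℕ, d 0 = 0 ∧ (∀ t < q, d t < d (t + 1)) ∧ p.1 < p.2 ∧
      p.2 + d q = a (q + 1) ∧ (∀ t < q, p.2 + d t ≤ p.1 + d (t + 1)) ∧
      ∀ t ≤ q + 1, edgeVertex d i p t = a t := by
  obtain ⟨i, hi, hmin⟩ := Finset.exists_min_image (Finset.range (q + 1))
    (fun t => a (t + 1) - a t) ⟨0, by simp⟩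
  simp only [Finset.mem_range] at hi hmin
  have hle : ∀ s t, s ≤ t → t ≤ q + 1 → a s ≤ a t := fun s t => le_of_lt_succ ha
  have hai := ha i hi
  have hap : ∀ t, i < t → t ≤ q → a 0 + (a (i + 1) - a i) ≤ a (t + 1) := by
    intro t h1 h2
    have h3 := hle (i + 1) (t + 1) (by omega) (by omega)
    have h4 := hle 0 i (by omega) (by omega)
    omega
  have hd : ∀ t < q, a 0 + (a (i + 1) - a i) +
      (if t ≤ i then a t - a 0 else a (t + 1) - (a 0 + (a (i + 1) - a i))) ≤
      a 0 + (if t + 1 ≤ i then a (t + 1) - a 0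
        else a (t + 1 + 1) - (a 0 + (a (i + 1) - a i))) := by
    intro t ht
    have h0 := hle 0 i (by omega) (by omega)
    have h1 := hle 0 t (by omega) (by omega)
    have h2 := ha t (by omega)
    have h3 := ha (t + 1) (by omega)
    have h4 := hmin t (by omega)
    have h5 := hmin (t + 1) (by omega)
    split_ifs with h6 h7 h7
    · omega
    · obtain rfl : t = i := by omega
      omega
    · omega
    · have := hap t (by omega) (by omega)
      omega
  refine ⟨i, by omega, fun t => if t ≤ i then a t - a 0 else a (t + 1) - (a 0 + (a (i + 1) - a i)),
    (a 0, a 0 + (a (i + 1) - a i)), by simp, fun t ht => ?_, by simp only; omega, ?_, hd, ?_⟩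
  · have := hd t ht
    simp only
    omega
  · have h0 := hle 0 i (by omega) (by omega)
    simp only
    split_ifs with h1
    · obtain rfl : q = i := by omega
      omega
    · have := hap q (by omega) le_rfl
      omega
  · intro t ht
    have h0 := hle 0 i (by omega) (by omega)
    unfold edgeVertex
    simp only
    split_ifs with h1 h2
    · have := hle 0 t (by omega) ht
      omega
    · obtain rfl : t = i + 1 := by omega
      simp only [Nat.add_sub_cancel]
      omega
    · have h3 := hap (t - 1) (by omega) (by omega)
      have h4 : t - 1 + 1 = t := by omega
      rw [h4] at h3 ⊢
      omega

/-- Edges of the same shape whose base pairs cross, and whose gaps are at least the pivot gap,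
form a crossing matching. -/
theorem edgeVertex_lt {q K i : ℕ} {d : ℕ → ℕ} {p : ℕ → ℕ × ℕ} (hd : ∀ t < q, d t < d (t + 1))
    (hp : ∀ l < K, (p l).1 < (p (l + 1)).1 ∧ (p l).2 < (p (l + 1)).2) (hK : (p K).1 < (p 0).2)
    (hgap : ∀ l ≤ K, ∀ t < q, (p l).2 + d t ≤ (p l).1 + d (t + 1)) {l l' t t' : ℕ}
    (hl : l ≤ K) (hl' : l' ≤ K) (ht' : t' ≤ q + 1) (h : t < t' ∨ (t = t' ∧ l < l')) (hi : i ≤ q) :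
    edgeVertex d i (p l) t < edgeVertex d i (p l') t' := by
  have h1 : ∀ l ≤ K, (p 0).1 ≤ (p l).1 ∧ (p l).1 ≤ (p K).1 := fun l hl =>
    ⟨le_of_lt_succ (f := fun l => (p l).1) (fun l hl => (hp l hl).1) (Nat.zero_le l) hl,
      le_of_lt_succ (f := fun l => (p l).1) (fun l hl => (hp l hl).1) hl le_rfl⟩
  have h2 : ∀ l ≤ K, (p 0).2 ≤ (p l).2 ∧ (p l).2 ≤ (p K).2 := fun l hl =>
    ⟨le_of_lt_succ (f := fun l => (p l).2) (fun l hl => (hp l hl).2) (Nat.zero_le l) hl,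
      le_of_lt_succ (f := fun l => (p l).2) (fun l hl => (hp l hl).2) hl le_rfl⟩
  have hl1 := h1 l hl
  have hl2 := h2 l hl
  have hl1' := h1 l' hl'
  have hl2' := h2 l' hl'
  unfold edgeVertex
  rcases h with h | ⟨rfl, h⟩
  · split_ifs with h3 h4 h4
    · have h5 := hgap 0 (Nat.zero_le K) t (by omega)
      have h6 : d (t + 1) ≤ d t' := le_of_lt_succ hd h (by omega)
      omega
    · have h6 : d t ≤ d (t' - 1) := le_of_lt_succ hd (by omega) (by omega)
      omega
    · omega
    · have h5 := hgap K le_rfl (t - 1) (by omega)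
      have h6 : d (t - 1 + 1) ≤ d (t' - 1) := le_of_lt_succ hd (by omega) (by omega)
      omega
  · have h3 : (p l).1 < (p l').1 :=
      lt_of_lt_succ (f := fun l => (p l).1) (fun l hl => (hp l hl).1) h hl'
    have h4 : (p l).2 < (p l').2 :=
      lt_of_lt_succ (f := fun l => (p l).2) (fun l hl => (hp l hl).2) h hl'
    split_ifs <;> omega

theorem exists_increasing_enumeration {n r : ℕ} {e : Finset (Fin n)} (he : e.card = r + 1) :
    ∃ a : ℕ → ℕ, (∀ t < r, a t < a (t + 1)) ∧ a r < n ∧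
      e.image Fin.val = (Finset.range (r + 1)).image a := by
  have hf : ∀ t, t < r + 1 → (Fin.ofNat (r + 1) t).val = t := fun t ht => Nat.mod_eq_of_lt ht
  refine ⟨fun t => (e.orderEmbOfFin he (Fin.ofNat (r + 1) t)).val, fun t ht => ?_, Fin.isLt _, ?_⟩
  · have : Fin.ofNat (r + 1) t < Fin.ofNat (r + 1) (t + 1) := by
      rw [Fin.lt_def, hf t (by omega), hf (t + 1) (by omega)]
      omega
    exact (e.orderEmbOfFin he).strictMono this
  · ext y
    simp only [Finset.mem_image, Finset.mem_range]
    constructor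
    · rintro ⟨x, hx, rfl⟩
      rw [← Finset.mem_coe, ← Finset.range_orderEmbOfFin e he] at hx
      obtain ⟨j, rfl⟩ := hx
      refine ⟨j, j.isLt, ?_⟩
      congr 3
      exact Fin.ext (hf j j.isLt)
    · rintro ⟨t, ht, rfl⟩
      exact ⟨_, Finset.orderEmbOfFin_mem e he _, rfl⟩

/-- A function on an initial segment, extended to all natural numbers. -/
def extendFin {q : ℕ} (d : Fin (q + 1) → ℕ) (t : ℕ) : ℕ := d (Fin.ofNat (q + 1) t)

theorem extendFin_restrict {q : ℕ} (d : ℕ → ℕ) {t : ℕ} (ht : t ≤ q) :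
    extendFin (fun j : Fin (q + 1) => d j) t = d t :=
  congrArg d (Nat.mod_eq_of_lt (Nat.lt_succ_of_le ht))

open Classical in
/-- The possible shapes of an edge: increasing sequences in `[0, n)` that start at `0`. -/
noncomputable def shapes (n q : ℕ) : Finset (Fin (q + 1) → ℕ) :=
  (Fintype.piFinset fun _ => Finset.range n).filter fun d =>
    extendFin d 0 = 0 ∧ ∀ t < q, extendFin d t < extendFin d (t + 1)

theorem mem_shapes {n q : ℕ} {d : Fin (q + 1) → ℕ} : d ∈ shapes n q ↔
    extendFin d q < n ∧ extendFin d 0 = 0 ∧ ∀ t < q, extendFin d t < extendFin d (t + 1) := by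
  simp only [shapes, Finset.mem_filter, Fintype.mem_piFinset, Finset.mem_range]
  refine ⟨fun h => ⟨h.1 _, h.2⟩, fun h => ⟨fun j => ?_, h.2⟩⟩
  have h1 := le_of_lt_succ h.2.2 (Nat.le_of_lt_succ j.isLt) le_rfl
  have h2 : extendFin d j = d j := congrArg d (Fin.ext (Nat.mod_eq_of_lt j.isLt))
  omega

theorem sum_shapes_le (n q : ℕ) :
    ∑ d ∈ shapes n q, (n - extendFin d q) ≤ n.choose (q + 1) := by
  classical
  have h1 : ∑ d ∈ shapes n q, (n - extendFin d q) =
      ((shapes n q).sigma fun d => Finset.range (n - extendFin d q)).card := by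
    simp [Finset.card_sigma]
  have hmono : ∀ d ∈ shapes n q, ∀ x, StrictMono fun j : Fin (q + 1) => x + d j := by
    intro d hd x
    rw [Fin.strictMono_iff_lt_succ]
    intro j
    have h2 := (mem_shapes.1 hd).2.2 j j.isLt
    have h3 : extendFin d j = d j.castSucc :=
      congrArg d (Fin.ext (Nat.mod_eq_of_lt (by simp)))
    have h4 : extendFin d (j + 1) = d j.succ :=
      congrArg d (Fin.ext (Nat.mod_eq_of_lt (by simp)))
    omega
  rw [h1, ← Finset.card_range n, ← Finset.card_powersetCard, Finset.card_range]
  refine Finset.card_le_card_of_injOn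
    (fun s => Finset.univ.image fun j : Fin (q + 1) => s.2 + s.1 j) ?_ ?_
  · rintro ⟨d, x⟩ hs
    simp only [Finset.coe_sigma, Set.mem_sigma_iff, Finset.mem_coe, Finset.mem_range] at hs
    simp only [Finset.mem_coe, Finset.mem_powersetCard]
    refine ⟨?_, ?_⟩
    · intro y hy
      obtain ⟨j, -, rfl⟩ := Finset.mem_image.1 hy
      have h2 := le_of_lt_succ (mem_shapes.1 hs.1).2.2 (Nat.le_of_lt_succ j.isLt) le_rfl
      have h3 : extendFin d j = d j := congrArg d (Fin.ext (Nat.mod_eq_of_lt j.isLt))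
      rw [Finset.mem_range]
      omega
    · rw [Finset.card_image_of_injective _ (hmono d hs.1 x).injective]
      simp
  · rintro ⟨d, x⟩ hs ⟨d', x'⟩ hs' h
    simp only [Finset.coe_sigma, Set.mem_sigma_iff, Finset.mem_coe] at hs hs' h
    have h2 : (fun j : Fin (q + 1) => x + d j) = fun j => x' + d' j := by
      refine ((hmono d hs.1 x).range_inj (hmono d' hs'.1 x')).1 ?_
      simpa using congrArg (fun s : Finset ℕ => (s : Set ℕ)) h
    have h3 : d 0 = 0 := (mem_shapes.1 hs.1).2.1
    have h4 : d' 0 = 0 := (mem_shapes.1 hs'.1).2.1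
    have h5 := congrFun h2 0
    simp only [h3, h4, add_zero] at h5
    subst h5
    have h6 : d = d' := funext fun j => Nat.add_left_cancel (congrFun h2 j)
    rw [h6]

section BasePairs

variable {n : ℕ} (H : Finset (Finset (Fin n))) (q i : ℕ) (d : ℕ → ℕ)

open Classical in
/-- The base pairs of the edges of `H` with shape `d` and pivot `i`, the pivot gap being smallest
possible. -/
noncomputable def basePairs : Finset (ℕ × ℕ) :=
  (Finset.range n ×ˢ Finset.range n).filter fun p => p.1 < p.2 ∧ p.2 + d q < n ∧
    (∀ t < q, p.2 + d t ≤ p.1 + d (t + 1)) ∧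
    (Finset.range (q + 2)).image (edgeVertex d i p) ∈ H.image (Finset.image Fin.val)

variable {H q i d}

theorem mem_basePairs {p : ℕ × ℕ} : p ∈ basePairs H q i d ↔ p.1 < p.2 ∧ p.2 + d q < n ∧
    (∀ t < q, p.2 + d t ≤ p.1 + d (t + 1)) ∧
    (Finset.range (q + 2)).image (edgeVertex d i p) ∈ H.image (Finset.image Fin.val) := by
  simp only [basePairs, Finset.mem_filter, Finset.mem_product, Finset.mem_range]
  refine ⟨fun h => h.2, fun h => ⟨⟨?_, ?_⟩, h⟩⟩ <;> omega

theorem exists_isCycCrossMatching {K : ℕ} (hd : ∀ t < q, d t < d (t + 1)) (hi : i ≤ q)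
    (h : HasCrossing (basePairs H q i d) K) :
    ∃ v : ℕ → Fin n, IsCycCrossMatching (q + 2) (K + 1) H v := by
  obtain ⟨p, hpE, hp, hK⟩ := h
  have hgap : ∀ l ≤ K, ∀ t < q, (p l).2 + d t ≤ (p l).1 + d (t + 1) :=
    fun l hl => (mem_basePairs.1 (hpE l hl)).2.2.1
  have hn : 0 < n := by
    have := (mem_basePairs.1 (hpE 0 (Nat.zero_le K))).2.1
    omega
  have : NeZero n := ⟨hn.ne'⟩
  set w : ℕ → ℕ := fun m => edgeVertex d i (p (m % (K + 1))) (m / (K + 1)) with hw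
  have hmod : ∀ m, m % (K + 1) ≤ K := fun m => Nat.le_of_lt_succ (Nat.mod_lt m (Nat.succ_pos K))
  have hdiv : ∀ m, m < (q + 2) * (K + 1) → m / (K + 1) ≤ q + 1 := fun m hm =>
    Nat.le_of_lt_succ (Nat.div_lt_of_lt_mul (by rwa [mul_comm]))
  have hwlt : ∀ m m', m < m' → m' < (q + 2) * (K + 1) → w m < w m' := by
    intro m m' hm hm'
    refine edgeVertex_lt hd hp hK hgap (hmod m) (hmod m') (hdiv m' hm') ?_ hi
    rcases (Nat.div_le_div_right (c := K + 1) hm.le).lt_or_eq with h | h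
    · exact Or.inl h
    · refine Or.inr ⟨h, ?_⟩
      have h1 := Nat.div_add_mod m (K + 1)
      have h2 := Nat.div_add_mod m' (K + 1)
      rw [h] at h1
      omega
  have hwn : ∀ m, m < (q + 2) * (K + 1) → w m < n := by
    intro m hm
    have h1 := (mem_basePairs.1 (hpE _ (hmod m))).2.1
    have h2 := (mem_basePairs.1 (hpE _ (hmod m))).1
    have h3 := hdiv m hm
    simp only [hw]
    unfold edgeVertex
    split_ifs with h4
    · have := le_of_lt_succ hd (h4.trans hi) le_rfl
      omega
    · have : d (m / (K + 1) - 1) ≤ d q := le_of_lt_succ hd (by omega) le_rfl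
      omega
  have hval : ∀ m, m < (q + 2) * (K + 1) → (Fin.ofNat n (w m)).val = w m :=
    fun m hm => Nat.mod_eq_of_lt (hwn m hm)
  refine ⟨fun m => Fin.ofNat n (w m), ?_, ?_⟩
  · intro a b hab hb
    have h0 : w 0 ≤ w a := by
      rcases a.eq_zero_or_pos with rfl | ha
      · exact le_rfl
      · exact (hwlt 0 a ha (by omega)).le
    have h1 := hwlt a b hab hb
    have e0 := hval 0 (by omega)
    have ea := hval a (by omega)
    have eb := hval b hb
    simp only
    rw [Fin.lt_def, Fin.sub_val_of_le (by rw [Fin.le_def]; omega),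
      Fin.sub_val_of_le (by rw [Fin.le_def]; omega)]
    omega
  · intro l hl
    obtain ⟨e, he, hee⟩ :=
      Finset.mem_image.1 (mem_basePairs.1 (hpE l (Nat.le_of_lt_succ hl))).2.2.2
    convert he
    refine Finset.image_injective Fin.val_injective ?_
    rw [hee, Finset.image_image]
    refine Finset.image_congr fun j hj => ?_
    rw [Finset.mem_coe, Finset.mem_range] at hj
    have hlt : l + j * (K + 1) < (q + 2) * (K + 1) := by nlinarith
    simp only [Function.comp]
    rw [hval _ hlt]
    simp only [hw]
    rw [Nat.add_mul_mod_self_right, Nat.mod_eq_of_lt hl, Nat.add_mul_div_right _ _ (Nat.succ_pos K),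
      Nat.div_eq_of_lt hl, zero_add]

theorem card_basePairs_le {K : ℕ} (hK : 0 < K) (hd : ∀ t < q, d t < d (t + 1)) (hi : i ≤ q)
    (h : ¬ ∃ v : ℕ → Fin n, IsCycCrossMatching (q + 2) (K + 1) H v) :
    (basePairs H q i d).card ≤ 2 * K * (n - d q - 1) := by
  refine card_le_of_not_hasCrossing hK _ _ (fun p hp => ?_)
    fun hc => h (exists_isCycCrossMatching hd hi hc)
  have h1 := (mem_basePairs.1 hp).1
  have h2 := (mem_basePairs.1 hp).2.1
  omega

end BasePairs

theorem card_le_sum_basePairs {n q : ℕ} (H : Finset (Finset (Fin n)))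
    (hH : ∀ e ∈ H, e.card = q + 2) :
    H.card ≤ ∑ i ∈ Finset.range (q + 1), ∑ d ∈ shapes n q,
      (basePairs H q i (extendFin d)).card := by
  classical
  rw [← Finset.card_image_of_injective H (Finset.image_injective Fin.val_injective),
    ← Finset.sum_product' (f := fun i d => (basePairs H q i (extendFin d)).card)]
  have hsub : H.image (Finset.image Fin.val) ⊆
      (Finset.range (q + 1) ×ˢ shapes n q).biUnion fun s =>
        (basePairs H q s.1 (extendFin s.2)).image fun p =>
          (Finset.range (q + 2)).image (edgeVertex (extendFin s.2) s.1 p) := by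
    intro e' he'
    obtain ⟨e, he, rfl⟩ := Finset.mem_image.1 he'
    obtain ⟨a, ha, han, hea⟩ := exists_increasing_enumeration (hH e he)
    obtain ⟨i, hi, d, p, hd0, hd, hp, hpq, hgap, hev⟩ := exists_edgeVertex_eq ha
    set δ : Fin (q + 1) → ℕ := fun j => d j
    have hδ : ∀ t ≤ q, extendFin δ t = d t := fun t ht => extendFin_restrict d ht
    have hev' : (Finset.range (q + 2)).image (edgeVertex (extendFin δ) i p) =
        e.image Fin.val := by
      rw [hea]
      refine Finset.image_congr fun t ht => ?_
      rw [Finset.mem_coe, Finset.mem_range] at ht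
      rw [← hev t (by omega)]
      unfold edgeVertex
      split_ifs with h1
      · rw [hδ t (by omega)]
      · rw [hδ (t - 1) (by omega)]
    refine Finset.mem_biUnion.2 ⟨(i, δ), Finset.mem_product.2
      ⟨Finset.mem_range.2 (by simp only; omega), mem_shapes.2 ⟨?_, ?_, ?_⟩⟩,
      Finset.mem_image.2 ⟨p, mem_basePairs.2 ⟨hp, ?_, ?_, ?_⟩, hev'⟩⟩
    · rw [hδ q le_rfl]
      omega
    · rw [hδ 0 (Nat.zero_le q), hd0]
    · intro t ht
      rw [hδ t ht.le, hδ (t + 1) ht]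
      exact hd t ht
    · simp only
      rw [hδ q le_rfl]
      omega
    · intro t ht
      simp only
      rw [hδ t ht.le, hδ (t + 1) ht]
      exact hgap t ht
    · simp only
      rwa [hev']
  exact (Finset.card_le_card hsub).trans (Finset.card_biUnion_le.trans
    (Finset.sum_le_sum fun s _ => Finset.card_image_le))

theorem card_lt_of_not_isCycCrossMatching {n q K : ℕ} (hK : 0 < K) (hn : q + 1 ≤ n)
    (H : Finset (Finset (Fin n))) (hH : ∀ e ∈ H, e.card = q + 2)
    (h : ¬ ∃ v : ℕ → Fin n, IsCycCrossMatching (q + 2) (K + 1) H v) :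
    H.card < 2 * K * (q + 1) * n.choose (q + 1) := by
  have hpos : 0 < n.choose (q + 1) := Nat.choose_pos hn
  have h1 : ∑ d ∈ shapes n q, (n - extendFin d q - 1) < n.choose (q + 1) := by
    rcases (shapes n q).eq_empty_or_nonempty with h0 | h0
    · simpa [h0] using hpos
    · refine (Finset.sum_lt_sum_of_nonempty h0 fun d hd => ?_).trans_le (sum_shapes_le n q)
      have := (mem_shapes.1 hd).1
      omega
  calc H.card
      ≤ ∑ i ∈ Finset.range (q + 1), ∑ d ∈ shapes n q, (basePairs H q i (extendFin d)).card :=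
        card_le_sum_basePairs H hH
    _ ≤ ∑ i ∈ Finset.range (q + 1), ∑ d ∈ shapes n q, 2 * K * (n - extendFin d q - 1) :=
        Finset.sum_le_sum fun i hi => Finset.sum_le_sum fun d hd =>
          card_basePairs_le hK (mem_shapes.1 hd).2.2
            (Nat.le_of_lt_succ (Finset.mem_range.1 hi)) h
    _ = 2 * K * (q + 1) * ∑ d ∈ shapes n q, (n - extendFin d q - 1) := by
        rw [Finset.sum_const, Finset.card_range, ← Finset.mul_sum, smul_eq_mul]
        ring
    _ < 2 * K * (q + 1) * n.choose (q + 1) := Nat.mul_lt_mul_of_pos_left h1 (by positivity)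

/-- For all `k > 2`, `r > 2` and `n ≥ r`,
`ex_↻(n, M_k^r) < 2(k−1)(r−1)·C(n, r−1)`. -/
theorem stmt17 (r k n : ℕ) (hk : 2 < k) (hr : 2 < r) (hn : r ≤ n) :
    exCycM n r k < 2 * (k - 1) * (r - 1) * n.choose (r - 1) := by
  obtain ⟨q, rfl⟩ : ∃ q, r = q + 2 := ⟨r - 2, by omega⟩
  obtain ⟨K, rfl⟩ : ∃ K, k = K + 1 := ⟨k - 1, by omega⟩
  have hlt : ∀ m ∈ {m | ∃ H : Finset (Finset (Fin n)), (∀ e ∈ H, e.card = q + 2) ∧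
      (¬ ∃ v : ℕ → Fin n, IsCycCrossMatching (q + 2) (K + 1) H v) ∧ H.card = m},
      m < 2 * K * (q + 1) * n.choose (q + 1) := by
    rintro m ⟨H, hH, hv, rfl⟩
    exact card_lt_of_not_isCycCrossMatching (by omega) (by omega) H hH hv
  refine hlt _ (Nat.sSup_mem ⟨0, ∅, by simp, ?_, rfl⟩ ⟨_, fun m hm => (hlt m hm).le⟩)
  rintro ⟨v, -, hv⟩
  simpa using hv 0 (Nat.succ_pos K)
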